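/- For every real x > 0, one has ((x + 2)/x²) · (x − 1 + e^{−x}) > 1. -/

import Mathlib

/-- The slow-driving/optimal excess-work ratio `((x + 2)/x²)(x − 1 + e^{−x})`
exceeds `1` for every `x > 0`. -/
theorem stmt16 (x : ℝ) (hx : 0 < x) :
    1 < ((x + 2)/x^2) * (x - 1 + Real.exp (-x)) := by
  have hd : ∀ y : ℝ, HasDerivAt (fun t : ℝ => t - 2 + (t + 2) * Real.exp (-t))
      (1 - (y + 1) * Real.exp (-y)) y := by
    intro y
    have h1 : HasDerivAt (fun t : ℝ => Real.exp (-t)) (Real.exp (-y) * (-1)) y :=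
      (hasDerivAt_neg y).exp
    have h2 := ((hasDerivAt_id y).sub_const 2).add (((hasDerivAt_id y).add_const 2).mul h1)
    refine h2.congr_deriv ?_
    simp only [id]
    ring
  have hm : StrictMonoOn (fun t : ℝ => t - 2 + (t + 2) * Real.exp (-t)) (Set.Ici 0) := by
    refine strictMonoOn_of_deriv_pos (convex_Ici 0)
      (fun y _ => (hd y).continuousAt.continuousWithinAt) ?_
    intro y hy
    rw [interior_Ici] at hy
    have hy0 : (0 : ℝ) < y := hy
    rw [(hd y).deriv]
    have h3 := Real.add_one_lt_exp hy0.ne'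
    have h4 : Real.exp y * Real.exp (-y) = 1 := by rw [← Real.exp_add]; simp
    have h5 := mul_lt_mul_of_pos_right h3 (Real.exp_pos (-y))
    linarith
  have h := hm (Set.mem_Ici.2 le_rfl) (Set.mem_Ici.2 hx.le) hx
  simp only [neg_zero, Real.exp_zero] at h
  rw [div_mul_eq_mul_div, lt_div_iff₀ (by positivity)]
  nlinarith
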